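/- Let r be a cycle and B > 0, with B_1,…,B_d determined by B = ∫_0^{B_i} χ_i(r_b) db. If B_1 ≥ ⋯ ≥ B_d, then δ(r,B) = Σ_{i∈D} (∫_0^{B_i} h(I_{≤i} | I_{≤i−1}; r_b) db) / (∫_0^{B_i} χ_i(r_b) db), and this quantity is at most Σ_{i∈D} h(I_{≤i} | I_{≤i−1}; R̂_{B_i}) / χ_i(R̂_{B_i}), where R̂_B = B^{-1}∫_0^B r_b db. In particular, if p ∈ P satisfies χ_1(p) ≤ ⋯ ≤ χ_d(p), then δ(p) = Σ_{i∈D} h(I_{≤i} | I_{≤i−1}; p) / χ_i(p). -/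

import Mathlib

open MeasureTheory Filter Set Metric
open scoped Classical Topology ENNReal NNReal

namespace SelfAffineSponge

/-- A diagonal IFS on `[0,1]^d`: for each coordinate `i ∈ D = Fin d` a finite alphabet
`A i` indexing affine maps `x ↦ slope i a * x + off i a` of `[0,1]`, together with a
set `E ⊆ ∏ i, A i` of allowed tuples of symbols. -/
structure DiagIFS (d : ℕ) (A : Fin d → Type) [∀ i, Fintype (A i)] where
  slope : ∀ i : Fin d, A i → ℝ
  off : ∀ i : Fin d, A i → ℝ
  E : Finset (∀ i, A i)

variable {d : ℕ} {A : Fin d → Type} [∀ i, Fintype (A i)]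

namespace DiagIFS

/-- the base similarity `φ_{i,a}` in coordinate `i` -/
def base (Φ : DiagIFS d A) (i : Fin d) (a : A i) (x : ℝ) : ℝ :=
  Φ.slope i a * x + Φ.off i a

/-- the data defines an honest diagonal IFS: `E` is nonempty and each base map is a
contracting similarity of `[0,1]` -/
def Valid (Φ : DiagIFS d A) : Prop :=
  Φ.E.Nonempty ∧ (∀ i a, Φ.slope i a ≠ 0) ∧ (∀ i a, |Φ.slope i a| < 1) ∧
    ∀ i a, ∀ x ∈ Set.Icc (0:ℝ) 1, Φ.base i a x ∈ Set.Icc (0:ℝ) 1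

/-- the alphabet `E` of the IFS, as a type -/
abbrev Symb (Φ : DiagIFS d A) : Type _ := {a : ∀ i, A i // a ∈ Φ.E}

instance (Φ : DiagIFS d A) : MeasurableSpace Φ.Symb := ⊤
instance (Φ : DiagIFS d A) : TopologicalSpace Φ.Symb := ⊥

/-- the affine contraction `φ_a` of `[0,1]^d` associated to a tuple of symbols -/
def affMap (Φ : DiagIFS d A) (a : ∀ i, A i) (x : Fin d → ℝ) : Fin d → ℝ :=
  fun i => Φ.base i (a i) (x i)

/-- the coding map `π(ω) = lim_n φ_{ω_0}∘⋯∘φ_{ω_{n-1}}(0)`, written in closed form -/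
noncomputable def coding (Φ : DiagIFS d A) (ω : ℕ → Φ.Symb) : Fin d → ℝ :=
  fun i => ∑' n : ℕ, (∏ k ∈ Finset.range n, Φ.slope i ((ω k).1 i)) * Φ.off i ((ω n).1 i)

/-- the limit set `Λ_Φ = π(E^ℕ)` (the self-affine sponge) -/
def limitSet (Φ : DiagIFS d A) : Set (Fin d → ℝ) :=
  Set.range Φ.coding

theorem coding_mem (Φ : DiagIFS d A) (ω : ℕ → Φ.Symb) : Φ.coding ω ∈ Φ.limitSet :=
  ⟨ω, rfl⟩

/-- the `i`-th Lyapunov exponent `χ_i(p) = -∫ log|φ'_{a,i}| dp(a)` of a finite measure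
`p` on `E` (given by its density) -/
noncomputable def chi (Φ : DiagIFS d A) (i : Fin d) (p : Φ.Symb → ℝ) : ℝ :=
  -∑ a : Φ.Symb, p a * Real.log |Φ.slope i (a.1 i)|

/-- the mass `p([a]_I)` of the cylinder `[a]_I = {b ∈ E : b_i = a_i ∀ i ∈ I}` -/
noncomputable def cylMass (Φ : DiagIFS d A) (I : Finset (Fin d)) (p : Φ.Symb → ℝ)
    (a : Φ.Symb) : ℝ :=
  ∑ b : Φ.Symb, if ∀ i ∈ I, b.1 i = a.1 i then p b else 0

/-- the entropy `h(I; p) = -∫ log p([a]_I) dp(a)` -/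
noncomputable def entropy (Φ : DiagIFS d A) (I : Finset (Fin d)) (p : Φ.Symb → ℝ) : ℝ :=
  -∑ a : Φ.Symb, p a * Real.log (Φ.cylMass I p a)

/-- the conditional entropy `h(I' | I; p) = h(I';p) - h(I;p)` -/
noncomputable def condEntropy (Φ : DiagIFS d A) (I I' : Finset (Fin d))
    (p : Φ.Symb → ℝ) : ℝ :=
  Φ.entropy I' p - Φ.entropy I p

/-- a coordinate set `I ⊆ D` is good if the projected IFS `Φ_I` satisfies the open set
condition: the boxes `φ_{I,a}((0,1)^I)`, indexed by distinct projections of elements of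
`E`, are pairwise disjoint (equivalently, some coordinate has disjoint intervals). -/
def GoodIdx (Φ : DiagIFS d A) (I : Finset (Fin d)) : Prop :=
  ∀ a ∈ Φ.E, ∀ b ∈ Φ.E, (∃ i ∈ I, a i ≠ b i) →
    ∃ i ∈ I, Disjoint (Φ.base i (a i) '' Set.Ioo (0:ℝ) 1)
      (Φ.base i (b i) '' Set.Ioo (0:ℝ) 1)

/-- Barański condition: each base IFS satisfies the open set condition w.r.t. `(0,1)` -/
def Baranski (Φ : DiagIFS d A) : Prop :=
  ∀ i : Fin d, ∀ a b : A i, a ≠ b →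
    Disjoint (Φ.base i a '' Set.Ioo (0:ℝ) 1) (Φ.base i b '' Set.Ioo (0:ℝ) 1)

/-- strong Barański condition: each base IFS satisfies the strong separation condition
w.r.t. `[0,1]` -/
def StronglyBaranski (Φ : DiagIFS d A) : Prop :=
  ∀ i : Fin d, ∀ a b : A i, a ≠ b →
    Disjoint (Φ.base i a '' Set.Icc (0:ℝ) 1) (Φ.base i b '' Set.Icc (0:ℝ) 1)

/-- coordinate ordering condition: some permutation `σ` of the coordinates has
`|φ'_{a,σ(1)}| > ⋯ > |φ'_{a,σ(d)}|` for all `a ∈ E` -/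
def CoordOrdering (Φ : DiagIFS d A) : Prop :=
  ∃ σ : Equiv.Perm (Fin d), ∀ a ∈ Φ.E, ∀ i j : Fin d, i < j →
    |Φ.slope (σ j) (a (σ j))| < |Φ.slope (σ i) (a (σ i))|

end DiagIFS

/-- a probability vector (probability measure on a finite set, via its density) -/
def IsProbVec {α : Type*} [Fintype α] (p : α → ℝ) : Prop :=
  (∀ a, 0 ≤ p a) ∧ ∑ a, p a = 1

/-- a measure `p` on `E` is good if `I(p,x) = {i : χ_i(p) ≤ x}` is good for all `x > 0` -/
def DiagIFS.GoodVec (Φ : DiagIFS d A) (p : Φ.Symb → ℝ) : Prop :=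
  ∀ x > 0, Φ.GoodIdx (Finset.univ.filter fun i => Φ.chi i p ≤ x)

/-- a cycle on `E`: a continuous exponentially `λ`-periodic map `(0,∞) → P`,
where `λ = 1` means constant -/
structure Cycle (Φ : DiagIFS d A) where
  lam : ℝ
  one_le_lam : 1 ≤ lam
  r : ℝ → Φ.Symb → ℝ
  prob : ∀ b > 0, IsProbVec (r b)
  cont : ContinuousOn r (Set.Ioi 0)
  periodic : ∀ b > 0, r (lam * b) = r b
  const_of_lam_eq_one : lam = 1 → ∀ b > 0, ∀ b' > 0, r b = r b'

/-- the number `B_i`, determined by `B = ∫_0^{B_i} χ_i(r_b) db` (written via `sInf`;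
for a cycle the function `x ↦ ∫_0^x χ_i(r_b) db` is continuous and strictly
increasing, so the infimum is the unique solution) -/
noncomputable def Bcoord (Φ : DiagIFS d A) (r : ℝ → Φ.Symb → ℝ) (B : ℝ) (i : Fin d) : ℝ :=
  sInf {x : ℝ | 0 ≤ x ∧ B ≤ ∫ b in Set.Ioc (0:ℝ) x, Φ.chi i (r b)}

/-- `δ(r, B) = B⁻¹ ∫_0^∞ h({i : b ≤ B_i}; r_b) db` -/
noncomputable def deltaRB (Φ : DiagIFS d A) (r : ℝ → Φ.Symb → ℝ) (B : ℝ) : ℝ :=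
  B⁻¹ * ∫ b in Set.Ioi (0:ℝ),
    Φ.entropy (Finset.univ.filter fun i => b ≤ Bcoord Φ r B i) (r b)

/-- `δ(r) = inf_{B ∈ [1,λ]} δ(r,B)` -/
noncomputable def Cycle.delta {Φ : DiagIFS d A} (c : Cycle Φ) : ℝ :=
  sInf (deltaRB Φ c.r '' Set.Icc 1 c.lam)

/-- `δ(p) = ∫_0^∞ h({i : b ≤ 1/χ_i(p)}; p) db` -/
noncomputable def deltaP (Φ : DiagIFS d A) (p : Φ.Symb → ℝ) : ℝ :=
  ∫ b in Set.Ioi (0:ℝ),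
    Φ.entropy (Finset.univ.filter fun i => b ≤ (Φ.chi i p)⁻¹) p

/-- the normalized average `R̂_B = B⁻¹ ∫_0^B r_b db` of a cycle -/
noncomputable def cycleAvg {Φ : DiagIFS d A} (c : Cycle Φ) (B : ℝ) : Φ.Symb → ℝ :=
  fun a => B⁻¹ * ∫ b in Set.Ioc (0:ℝ) B, c.r b a

/-- a cycle is good if all its normalized averages `R̂_B` are good -/
def Cycle.Good {Φ : DiagIFS d A} (c : Cycle Φ) : Prop :=
  ∀ B > 0, Φ.GoodVec (cycleAvg c B)

/-- a cycle is nondegenerate if `{b > 0 : r_b(a) > 0 ∀ a ∈ E_r}` is dense in `(0,∞)` -/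
def Cycle.Nondeg {Φ : DiagIFS d A} (c : Cycle Φ) : Prop :=
  Set.Ioi (0:ℝ) ⊆
    closure {b : ℝ | 0 < b ∧ ∀ a : Φ.Symb, (∃ b' > 0, 0 < c.r b' a) → 0 < c.r b a}

/-- the lower pointwise dimension `d̲(x,μ) = liminf_{ρ→0} log μ(B(x,ρ))/log ρ` -/
noncomputable def lowerPtDim {X : Type*} [PseudoMetricSpace X] [MeasurableSpace X]
    (μ : Measure X) (x : X) : ℝ≥0∞ :=
  Filter.liminf
    (fun ρ : ℝ => ENNReal.ofReal (Real.log (μ (Metric.ball x ρ)).toReal / Real.log ρ))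
    (𝓝[>] (0:ℝ))

/-- the Hausdorff dimension of a measure: the essential supremum of its lower
pointwise dimension -/
noncomputable def measDim {X : Type*} [PseudoMetricSpace X] [MeasurableSpace X]
    (μ : Measure X) : ℝ≥0∞ :=
  essSup (lowerPtDim μ) μ

/-- the shift map on `E^ℕ` -/
def shift {α : Type*} (ω : ℕ → α) : ℕ → α := fun n => ω (n + 1)

/-- the dynamical dimension: the supremum of `HD(π_*μ)` over shift-invariant
probability measures `μ` on `E^ℕ` -/
noncomputable def DiagIFS.dynDim (Φ : DiagIFS d A) : ℝ≥0∞ :=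
  sSup {x : ℝ≥0∞ | ∃ μ : Measure (ℕ → Φ.Symb), IsProbabilityMeasure μ ∧
    Measure.map shift μ = μ ∧ x = measDim (Measure.map Φ.coding μ)}

/-- `μ` is the product measure on `E^ℕ` whose `k`-th factor has density `p k`
(this property characterizes `μ` uniquely) -/
def IsProductMeasure (Φ : DiagIFS d A) (p : ℕ → Φ.Symb → ℝ)
    (μ : Measure (ℕ → Φ.Symb)) : Prop :=
  IsProbabilityMeasure μ ∧
    ∀ (n : ℕ) (w : ℕ → Φ.Symb),
      (μ {ω | ∀ k < n, ω k = w k}).toReal = ∏ k ∈ Finset.range n, p k (w k)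

/-- the set of Hausdorff dimensions of Bernoulli measures `ν_p = π_*[p^ℕ]` -/
noncomputable def bernoulliDims (Φ : DiagIFS d A) : Set ℝ≥0∞ :=
  {x | ∃ p : Φ.Symb → ℝ, IsProbVec p ∧ ∃ μ : Measure (ℕ → Φ.Symb),
    IsProductMeasure Φ (fun _ => p) μ ∧ x = measDim (Measure.map Φ.coding μ)}

/-- the set of Hausdorff dimensions of pseudo-Bernoulli measures
`ν_r = π_*[∏_n r_n]` -/
noncomputable def pseudoBernoulliDims (Φ : DiagIFS d A) : Set ℝ≥0∞ :=
  {x | ∃ c : Cycle Φ, ∃ μ : Measure (ℕ → Φ.Symb),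
    IsProductMeasure Φ (fun n => c.r ((n : ℝ) + 1)) μ ∧
      x = measDim (Measure.map Φ.coding μ)}


/-- The log-sum inequality in tangent form: each summand `x₁ log (y₁ / x₁)` is bounded by the
tangent plane of `(x, y) ↦ x log (y / x)` at the point `(x, y)`. -/
theorem mul_log_sub_log_le_tangent {x₁ y₁ x y : ℝ} (hx₁ : 0 ≤ x₁) (hxy₁ : x₁ ≤ y₁) (hx : 0 < x)
    (hy : 0 < y) :
    x₁ * (Real.log y₁ - Real.log x₁) ≤
      x₁ * (Real.log y - Real.log x) + (y₁ * x / y - x₁) := by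
  rcases hx₁.eq_or_lt with rfl | hpos
  · simp only [zero_mul, sub_zero, zero_add]
    positivity
  · have hy₁ : 0 < y₁ := hpos.trans_le hxy₁
    have hlog := Real.log_le_sub_one_of_pos (show 0 < (y₁ * x) / (x₁ * y) by positivity)
    rw [Real.log_div (by positivity) (by positivity), Real.log_mul hy₁.ne' hx.ne',
      Real.log_mul hpos.ne' hy.ne'] at hlog
    have hmul := mul_le_mul_of_nonneg_left hlog hx₁
    have heq : x₁ * ((y₁ * x) / (x₁ * y) - 1) = y₁ * x / y - x₁ := by
      field_simp
    linarith

/-- The function `(x, y) ↦ x log (y / x)` is concave on `{0 ≤ x ≤ y}`. -/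
theorem concaveOn_mul_log_sub_log :
    ConcaveOn ℝ {z : ℝ × ℝ | 0 ≤ z.1 ∧ z.1 ≤ z.2}
      (fun z => z.1 * (Real.log z.2 - Real.log z.1)) := by
  have hconv : Convex ℝ {z : ℝ × ℝ | 0 ≤ z.1 ∧ z.1 ≤ z.2} := by
    intro u hu v hv s t hs ht _
    simp only [mem_ofPred_eq, Prod.fst_add, Prod.smul_fst, Prod.snd_add, Prod.smul_snd,
      smul_eq_mul] at *
    exact ⟨add_nonneg (mul_nonneg hs hu.1) (mul_nonneg ht hv.1),
      add_le_add (mul_le_mul_of_nonneg_left hu.2 hs) (mul_le_mul_of_nonneg_left hv.2 ht)⟩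
  refine ⟨hconv, ?_⟩
  intro u hu v hv s t hs ht hst
  have hw := hconv hu hv hs ht hst
  simp only [mem_ofPred_eq, Prod.fst_add, Prod.smul_fst, Prod.snd_add, Prod.smul_snd,
    smul_eq_mul] at *
  rcases hw.1.eq_or_lt with hx | hx
  · have h₁ := mul_nonneg hs hu.1
    have h₂ := mul_nonneg ht hv.1
    rw [← mul_assoc, ← mul_assoc, show s * u.1 = 0 by linarith, show t * v.1 = 0 by linarith]
    simp
  · have hy := hx.trans_le hw.2
    have h₁ := mul_le_mul_of_nonneg_left (mul_log_sub_log_le_tangent hu.1 hu.2 hx hy) hs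
    have h₂ := mul_le_mul_of_nonneg_left (mul_log_sub_log_le_tangent hv.1 hv.2 hx hy) ht
    generalize hX : s * u.1 + t * v.1 = X at *
    generalize hY : s * u.2 + t * v.2 = Y at *
    have hsum : s * (u.2 * X / Y - u.1) + t * (v.2 * X / Y - v.1) = 0 := by
      have : s * (u.2 * X / Y - u.1) + t * (v.2 * X / Y - v.1) =
          (s * u.2 + t * v.2) * X / Y - (s * u.1 + t * v.1) := by ring
      rw [this, hX, hY]
      field_simp
      ring
    calc _ ≤ (s * u.1 + t * v.1) * (Real.log Y - Real.log X)
          + (s * (u.2 * X / Y - u.1) + t * (v.2 * X / Y - v.1)) := by linarith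
      _ = _ := by rw [hsum, hX, add_zero]

/-- A set function vanishing at `∅` telescopes along a lower set of a finite linear order. -/
theorem eq_sum_Iic_sub_Iio {n : ℕ} (f : Finset (Fin n) → ℝ) (hf : f ∅ = 0)
    (S : Finset (Fin n)) (hS : ∀ i j, i ≤ j → j ∈ S → i ∈ S) :
    f S = ∑ i ∈ S, (f (Finset.Iic i) - f (Finset.Iio i)) := by
  induction S using Finset.induction_on_max with
  | empty => simpa using hf
  | insert a T hT ih =>
    have ha : a ∉ T := fun h => lt_irrefl _ (hT a h)
    have hIio : T = Finset.Iio a := by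
      ext i
      refine ⟨fun h => Finset.mem_Iio.2 (hT i h), fun h => ?_⟩
      have hlt := Finset.mem_Iio.1 h
      exact (Finset.mem_insert.1 (hS i a hlt.le (Finset.mem_insert_self _ _))).resolve_left hlt.ne
    have hIic : insert a T = Finset.Iic a := by rw [hIio, Finset.Iio_insert]
    have hlow : ∀ i j, i ≤ j → j ∈ T → i ∈ T := fun i j hij hj => by
      rw [hIio, Finset.mem_Iio] at *
      exact hij.trans_lt hj
    rw [Finset.sum_insert ha, ← ih hlow, ← hIic, ← hIio]
    ring

namespace DiagIFS

/-- The projection of a tuple of symbols to the coordinates in `I`. -/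
def proj (Φ : DiagIFS d A) (I : Finset (Fin d)) (a : Φ.Symb) : ∀ i : I, A i :=
  fun i => a.1 i

/-- The image of the measure `p` under the projection to the coordinates in `I`. -/
noncomputable def marginal (Φ : DiagIFS d A) (I : Finset (Fin d)) (p : Φ.Symb → ℝ)
    (x : ∀ i : I, A i) : ℝ :=
  ∑ b : Φ.Symb, if Φ.proj I b = x then p b else 0

theorem cylMass_eq_marginal (Φ : DiagIFS d A) (I : Finset (Fin d)) (p : Φ.Symb → ℝ)
    (a : Φ.Symb) : Φ.cylMass I p a = Φ.marginal I p (Φ.proj I a) := by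
  unfold cylMass marginal
  refine Finset.sum_congr rfl fun b _ => if_congr ?_ rfl rfl
  simp [proj, funext_iff]

theorem sum_mul_comp_proj (Φ : DiagIFS d A) (I : Finset (Fin d)) (p : Φ.Symb → ℝ)
    (F : (∀ i : I, A i) → ℝ) :
    ∑ a, p a * F (Φ.proj I a) = ∑ x, Φ.marginal I p x * F x := by
  simp only [marginal, Finset.sum_mul]
  rw [Finset.sum_comm]
  simp [ite_mul]

theorem entropy_eq_sum_negMulLog (Φ : DiagIFS d A) (I : Finset (Fin d)) (p : Φ.Symb → ℝ) :
    Φ.entropy I p = ∑ x, Real.negMulLog (Φ.marginal I p x) := by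
  simp only [entropy, cylMass_eq_marginal, Real.negMulLog, neg_mul, Finset.sum_neg_distrib]
  rw [Φ.sum_mul_comp_proj I p fun x => Real.log (Φ.marginal I p x)]

theorem condEntropy_eq_sum (Φ : DiagIFS d A) {I J : Finset (Fin d)} (hIJ : I ⊆ J)
    (p : Φ.Symb → ℝ) :
    Φ.condEntropy I J p = ∑ x, Φ.marginal J p x *
      (Real.log (Φ.marginal I p fun i => x ⟨i, hIJ i.2⟩) - Real.log (Φ.marginal J p x)) := by
  rw [← Φ.sum_mul_comp_proj J p fun x =>
    Real.log (Φ.marginal I p fun i => x ⟨i, hIJ i.2⟩) - Real.log (Φ.marginal J p x)]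
  simp only [condEntropy, entropy, cylMass_eq_marginal, mul_sub, Finset.sum_sub_distrib]
  rw [neg_sub_neg]
  rfl

theorem marginal_nonneg (Φ : DiagIFS d A) (I : Finset (Fin d)) {p : Φ.Symb → ℝ}
    (hp : ∀ a, 0 ≤ p a) (x : ∀ i : I, A i) : 0 ≤ Φ.marginal I p x :=
  Finset.sum_nonneg fun b _ => by split_ifs <;> simp [hp b]

theorem marginal_mono (Φ : DiagIFS d A) {I J : Finset (Fin d)} (hIJ : I ⊆ J)
    {p : Φ.Symb → ℝ} (hp : ∀ a, 0 ≤ p a) (x : ∀ i : J, A i) :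
    Φ.marginal J p x ≤ Φ.marginal I p fun i => x ⟨i, hIJ i.2⟩ := by
  refine Finset.sum_le_sum fun b _ => ?_
  by_cases h : Φ.proj J b = x
  · rw [if_pos h, if_pos (by subst h; rfl)]
  · rw [if_neg h]
    split_ifs <;> simp [hp b]

theorem marginal_combo (Φ : DiagIFS d A) (I : Finset (Fin d)) (p q : Φ.Symb → ℝ) (s t : ℝ)
    (x : ∀ i : I, A i) :
    Φ.marginal I (s • p + t • q) x = s * Φ.marginal I p x + t * Φ.marginal I q x := by
  simp only [marginal, Finset.mul_sum, ← Finset.sum_add_distrib]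
  refine Finset.sum_congr rfl fun b _ => ?_
  split_ifs <;> simp

theorem concaveOn_condEntropy (Φ : DiagIFS d A) {I J : Finset (Fin d)} (hIJ : I ⊆ J) :
    ConcaveOn ℝ (stdSimplex ℝ Φ.Symb) (Φ.condEntropy I J) := by
  refine ⟨convex_stdSimplex ℝ _, fun p hp q hq s t hs ht hst => ?_⟩
  simp only [condEntropy_eq_sum Φ hIJ, smul_eq_mul, Finset.mul_sum, ← Finset.sum_add_distrib]
  refine Finset.sum_le_sum fun x _ => ?_
  have h := concaveOn_mul_log_sub_log.2
    (x := (Φ.marginal J p x, Φ.marginal I p fun i => x ⟨i, hIJ i.2⟩))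
    ⟨Φ.marginal_nonneg J hp.1 x, Φ.marginal_mono hIJ hp.1 x⟩
    (y := (Φ.marginal J q x, Φ.marginal I q fun i => x ⟨i, hIJ i.2⟩))
    ⟨Φ.marginal_nonneg J hq.1 x, Φ.marginal_mono hIJ hq.1 x⟩ hs ht hst
  simpa only [marginal_combo, Prod.fst_add, Prod.smul_fst, Prod.snd_add, Prod.smul_snd,
    smul_eq_mul] using h

theorem continuous_entropy (Φ : DiagIFS d A) (I : Finset (Fin d)) :
    Continuous (Φ.entropy I) := by
  simp only [funext (Φ.entropy_eq_sum_negMulLog I)]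
  refine continuous_finsetSum _ fun x _ => Real.continuous_negMulLog.comp ?_
  refine continuous_finsetSum _ fun b _ => ?_
  split_ifs <;> fun_prop

theorem continuous_condEntropy (Φ : DiagIFS d A) (I J : Finset (Fin d)) :
    Continuous (Φ.condEntropy I J) :=
  (Φ.continuous_entropy J).sub (Φ.continuous_entropy I)

theorem continuous_chi (Φ : DiagIFS d A) (i : Fin d) : Continuous (Φ.chi i) := by
  unfold chi
  fun_prop

theorem entropy_empty (Φ : DiagIFS d A) {p : Φ.Symb → ℝ} (hp : IsProbVec p) :
    Φ.entropy ∅ p = 0 := by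
  simp only [entropy, cylMass, Finset.notMem_empty, false_imp_iff, implies_true, if_true, hp.2,
    Real.log_one, mul_zero, Finset.sum_const_zero, neg_zero]

theorem chi_pos (Φ : DiagIFS d A) (hV : Φ.Valid) (i : Fin d) {p : Φ.Symb → ℝ}
    (hp : IsProbVec p) : 0 < Φ.chi i p := by
  have hlog : ∀ a : Φ.Symb, Real.log |Φ.slope i (a.1 i)| < 0 := fun a =>
    Real.log_neg (abs_pos.2 (hV.2.1 i _)) (hV.2.2.1 i _)
  unfold chi
  rw [← Finset.sum_neg_distrib]
  obtain ⟨a, -, ha⟩ := Finset.exists_ne_zero_of_sum_ne_zero (hp.2 ▸ one_ne_zero)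
  exact Finset.sum_pos' (fun b _ => neg_nonneg.2 (mul_nonpos_of_nonneg_of_nonpos (hp.1 b)
    (hlog b).le)) ⟨a, Finset.mem_univ a, neg_pos.2 (mul_neg_of_pos_of_neg
      ((hp.1 a).lt_of_ne' ha) (hlog a))⟩

theorem exists_pos_le_chi (Φ : DiagIFS d A) (hV : Φ.Valid) (i : Fin d) :
    ∃ m > 0, ∀ p : Φ.Symb → ℝ, IsProbVec p → m ≤ Φ.chi i p := by
  rcases (stdSimplex ℝ Φ.Symb).eq_empty_or_nonempty with h | h
  · exact ⟨1, one_pos, fun p hp => absurd (show p ∈ stdSimplex ℝ Φ.Symb from hp) (by simp [h])⟩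
  · obtain ⟨q, hq, hmin⟩ := (isCompact_stdSimplex ℝ Φ.Symb).exists_isMinOn h
      (Φ.continuous_chi i).continuousOn
    exact ⟨_, Φ.chi_pos hV i hq, fun p hp => hmin hp⟩

/-- A continuous function is integrable on `(0, x]` along a continuous path of probability
vectors on `(0, ∞)`. -/
theorem integrableOn_comp {Φ : DiagIFS d A} {F : Type*} [NormedAddCommGroup F]
    {K : (Φ.Symb → ℝ) → F} (hK : Continuous K)
    {r : ℝ → Φ.Symb → ℝ} (hr : ContinuousOn r (Ioi 0)) (hprob : ∀ b > 0, IsProbVec (r b))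
    (x : ℝ) : IntegrableOn (fun b => K (r b)) (Ioc 0 x) := by
  obtain ⟨C, hC⟩ := (isCompact_stdSimplex ℝ Φ.Symb).exists_bound_of_continuousOn hK.continuousOn
  refine IntegrableOn.of_bound measure_Ioc_lt_top
    ((hK.comp_continuousOn (hr.mono Ioc_subset_Ioi_self)).aestronglyMeasurable measurableSet_Ioc)
    C ?_
  exact (ae_restrict_iff' measurableSet_Ioc).2 (ae_of_all _ fun b hb => hC _ (hprob b hb.1))

theorem integral_entropy_filter (Φ : DiagIFS d A) {r : ℝ → Φ.Symb → ℝ}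
    (hr : ContinuousOn r (Ioi 0)) (hprob : ∀ b > 0, IsProbVec (r b)) {T : Fin d → ℝ}
    (hT : Antitone T) :
    ∫ b in Ioi (0:ℝ), Φ.entropy (Finset.univ.filter fun i => b ≤ T i) (r b) =
      ∑ i, ∫ b in Ioc (0:ℝ) (T i), Φ.condEntropy (Finset.Iio i) (Finset.Iic i) (r b) := by
  have hpt : ∀ b ∈ Ioi (0:ℝ), Φ.entropy (Finset.univ.filter fun i => b ≤ T i) (r b) =
      ∑ i, (Iic (T i)).indicator
        (fun b => Φ.condEntropy (Finset.Iio i) (Finset.Iic i) (r b)) b := by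
    intro b hb
    rw [eq_sum_Iic_sub_Iio (fun I => Φ.entropy I (r b)) (Φ.entropy_empty (hprob b hb)) _
      (fun i j hij hj => by
        simp only [Finset.mem_filter, Finset.mem_univ, true_and] at hj ⊢
        exact hj.trans (hT hij)), Finset.sum_filter]
    rfl
  rw [setIntegral_congr_fun measurableSet_Ioi hpt, integral_finsetSum]
  · refine Finset.sum_congr rfl fun i _ => ?_
    rw [setIntegral_indicator measurableSet_Iic, Ioi_inter_Iic]
  · intro i _
    rw [integrable_indicator_iff measurableSet_Iic, IntegrableOn,
      Measure.restrict_restrict measurableSet_Iic, inter_comm, Ioi_inter_Iic]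
    exact integrableOn_comp (Φ.continuous_condEntropy _ _) hr hprob _

theorem Bcoord_spec (Φ : DiagIFS d A) (hV : Φ.Valid) {r : ℝ → Φ.Symb → ℝ}
    (hr : ContinuousOn r (Ioi 0)) (hprob : ∀ b > 0, IsProbVec (r b)) {B : ℝ} (hB : 0 < B)
    (i : Fin d) :
    0 < Bcoord Φ r B i ∧ ∫ b in Ioc (0:ℝ) (Bcoord Φ r B i), Φ.chi i (r b) = B := by
  obtain ⟨m, hm, hchi⟩ := Φ.exists_pos_le_chi hV i
  have hint : ∀ x, IntegrableOn (fun b => Φ.chi i (r b)) (Ioc 0 x) :=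
    integrableOn_comp (Φ.continuous_chi i) hr hprob
  have hgrow : ∀ x y, 0 ≤ x → x ≤ y → (∫ b in Ioc (0:ℝ) x, Φ.chi i (r b)) + m * (y - x) ≤
      ∫ b in Ioc (0:ℝ) y, Φ.chi i (r b) := by
    intro x y hx hxy
    have hsub : Ioc x y ⊆ Ioc 0 y := Ioc_subset_Ioc_left hx
    rw [← Ioc_union_Ioc_eq_Ioc hx hxy, setIntegral_union (Ioc_disjoint_Ioc_of_le le_rfl)
      measurableSet_Ioc (hint x) ((hint y).mono_set hsub)]
    gcongr
    have h := setIntegral_mono_on (integrableOn_const (C := m) measure_Ioc_lt_top.ne)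
      ((hint y).mono_set hsub) measurableSet_Ioc fun b hb => hchi _ (hprob b (hx.trans_lt hb.1))
    simpa [hxy, mul_comm] using h
  have hzero : ∫ b in Ioc (0:ℝ) 0, Φ.chi i (r b) = 0 := by simp
  have hX : 0 ≤ B / m := by positivity
  have hcont : ContinuousOn (fun x => ∫ b in Ioc (0:ℝ) x, Φ.chi i (r b)) (Icc 0 (B / m)) :=
    intervalIntegral.continuousOn_primitive ((integrableOn_Icc_iff_integrableOn_Ioc (by simp)).2 (hint _))
  obtain ⟨x, hx, hxB⟩ := intermediate_value_Icc hX hcont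
    (show B ∈ Icc _ _ from ⟨by simpa using hB.le, by
      have h := hgrow 0 (B / m) le_rfl hX
      rw [hzero, zero_add, sub_zero, mul_div_cancel₀ _ hm.ne'] at h
      exact h⟩)
  simp only at hxB
  have hxpos : 0 < x := hx.1.lt_of_ne (by rintro rfl; rw [hzero] at hxB; exact hB.ne hxB)
  have hleast : IsLeast {x : ℝ | 0 ≤ x ∧ B ≤ ∫ b in Ioc (0:ℝ) x, Φ.chi i (r b)} x := by
    refine ⟨⟨hx.1, hxB.ge⟩, fun y hy => ?_⟩
    by_contra! hlt
    have h := hgrow y x hy.1 hlt.le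
    have := mul_pos hm (sub_pos.2 hlt)
    linarith [hy.2]
  have hBx : Bcoord Φ r B i = x := hleast.csInf_eq
  rw [hBx]
  exact ⟨hxpos, hxB⟩

end DiagIFS

section CycleAvg

variable {Φ : DiagIFS d A} (c : Cycle Φ) {T : ℝ}

theorem Cycle.integrableOn (x : ℝ) : IntegrableOn c.r (Ioc 0 x) :=
  DiagIFS.integrableOn_comp continuous_id c.cont c.prob x

theorem cycleAvg_eq_average (hT : 0 < T) : cycleAvg c T = ⨍ b in Ioc (0:ℝ) T, c.r b := by
  funext a
  have h := (ContinuousLinearMap.proj (R := ℝ) (φ := fun _ : Φ.Symb => ℝ) a).integral_comp_comm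
    (c.integrableOn T)
  simp only [ContinuousLinearMap.proj_apply] at h
  rw [setAverage_eq, Pi.smul_apply, ← h]
  simp [cycleAvg, hT.le]

theorem chi_cycleAvg (i : Fin d) :
    Φ.chi i (cycleAvg c T) = T⁻¹ * ∫ b in Ioc (0:ℝ) T, Φ.chi i (c.r b) := by
  unfold DiagIFS.chi
  rw [integral_neg, integral_finsetSum]
  · simp only [integral_mul_const, cycleAvg, mul_neg, Finset.mul_sum, mul_assoc]
  · intro a _
    exact DiagIFS.integrableOn_comp (K := fun p => p a * Real.log |Φ.slope i (a.1 i)|)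
      (by fun_prop) c.cont c.prob T

theorem integral_condEntropy_le (hT : 0 < T) {I J : Finset (Fin d)} (hIJ : I ⊆ J) :
    T⁻¹ * ∫ b in Ioc (0:ℝ) T, Φ.condEntropy I J (c.r b) ≤ Φ.condEntropy I J (cycleAvg c T) := by
  have h := (Φ.concaveOn_condEntropy hIJ).le_map_set_average (μ := volume) (t := Ioc 0 T) (f := c.r)
    (Φ.continuous_condEntropy I J).continuousOn (isClosed_stdSimplex ℝ Φ.Symb)
    (by simp [hT]) measure_Ioc_lt_top.ne
    ((ae_restrict_iff' measurableSet_Ioc).2 (ae_of_all _ fun b hb => c.prob b hb.1))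
    (c.integrableOn T)
    (DiagIFS.integrableOn_comp (Φ.continuous_condEntropy I J) c.cont c.prob T)
  rw [← cycleAvg_eq_average c hT, setAverage_eq] at h
  simpa [hT.le] using h

end CycleAvg

/-- If `B_1 ≥ ⋯ ≥ B_d`, then `δ(r,B)` is the sum over `i` of
`(∫_0^{B_i} h(I_{≤i}|I_{≤i-1}; r_b) db)/(∫_0^{B_i} χ_i(r_b) db)`, which is at most
`Σ_i h(I_{≤i}|I_{≤i-1}; R̂_{B_i})/χ_i(R̂_{B_i})`; in particular for `p ∈ P` with
`χ_1(p) ≤ ⋯ ≤ χ_d(p)` we have `δ(p) = Σ_i h(I_{≤i}|I_{≤i-1};p)/χ_i(p)`. -/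
theorem deltaRB_eq_sum {d : ℕ} {A : Fin d → Type} [∀ i, Fintype (A i)]
    (Φ : DiagIFS d A) (hV : Φ.Valid) (c : Cycle Φ) (B : ℝ) (hB : 0 < B)
    (hanti : Antitone fun i : Fin d => Bcoord Φ c.r B i) :
    (deltaRB Φ c.r B = ∑ i : Fin d,
      (∫ b in Set.Ioc (0:ℝ) (Bcoord Φ c.r B i),
          Φ.condEntropy (Finset.Iio i) (Finset.Iic i) (c.r b)) /
      (∫ b in Set.Ioc (0:ℝ) (Bcoord Φ c.r B i), Φ.chi i (c.r b))) ∧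
    (deltaRB Φ c.r B ≤ ∑ i : Fin d,
      Φ.condEntropy (Finset.Iio i) (Finset.Iic i) (cycleAvg c (Bcoord Φ c.r B i)) /
      Φ.chi i (cycleAvg c (Bcoord Φ c.r B i))) ∧
    (∀ p : Φ.Symb → ℝ, IsProbVec p → (Monotone fun i : Fin d => Φ.chi i p) →
      deltaP Φ p = ∑ i : Fin d,
        Φ.condEntropy (Finset.Iio i) (Finset.Iic i) p / Φ.chi i p) := by
  have hspec := Φ.Bcoord_spec hV c.cont c.prob hB
  have hsum : deltaRB Φ c.r B = ∑ i : Fin d,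
      (∫ b in Set.Ioc (0:ℝ) (Bcoord Φ c.r B i),
          Φ.condEntropy (Finset.Iio i) (Finset.Iic i) (c.r b)) /
      (∫ b in Set.Ioc (0:ℝ) (Bcoord Φ c.r B i), Φ.chi i (c.r b)) := by
    rw [deltaRB, Φ.integral_entropy_filter c.cont c.prob hanti, Finset.mul_sum]
    exact Finset.sum_congr rfl fun i _ => by rw [(hspec i).2, div_eq_inv_mul]
  refine ⟨hsum, hsum.trans_le (Finset.sum_le_sum fun i _ => ?_), fun p hp hmono => ?_⟩
  · have hT := (hspec i).1
    rw [chi_cycleAvg, (hspec i).2, ← mul_div_mul_left _ B (inv_ne_zero hT.ne')]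
    gcongr
    exact integral_condEntropy_le c hT Finset.Iio_subset_Iic_self
  · rw [deltaP, Φ.integral_entropy_filter (r := fun _ => p) continuousOn_const (fun _ _ => hp)
      fun i j hij => inv_anti₀ (Φ.chi_pos hV i hp) (hmono hij)]
    refine Finset.sum_congr rfl fun i _ => ?_
    have hpos := Φ.chi_pos hV i hp
    simp [hpos.le, div_eq_inv_mul]

end SelfAffineSponge
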